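/- arXiv:1204.2504 — 2 statements merged into one kernel-verified Lean document; each statement's English description precedes it below -/
import Mathlib

section
/- Let 0 < 2π < ln ρ and let f ∈ K^π be a C^1 Lorenz map renormalizable of monotone combinatorial type (0 1^n, 1 0^m) with central intervals L=[p,c), R=(c,q]. Then |L| ≤ ((c_1^−−c)·c^ρ·e^{π}/c_1^−)^{1/(ρ+1)}·((γ^{−1}−1)/(γ^{−n}−1))^{1/(ρ+1)} and |R| ≤ ((c−c_1^+)·μ^ρ·e^{π}/(1−c_1^+))^{1/(ρ+1)}·((γ^{−1}−1)/(γ^{−m}−1))^{1/(ρ+1)}. -/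
open Set

/-- The Lorenz map `f = (u,v,c,φ,ψ)` with critical exponent `ρ`:
`f(x) = φ(u(1-((c-x)/c)^ρ))` for `x < c` and `f(x) = ψ(1+v(-1+((x-c)/(1-c))^ρ))`
for `x ≥ c` (by convention, at the critical point `c` we take the right branch). -/
noncomputable def lorenzF (ρ u v c : ℝ) (φ ψ : ℝ → ℝ) : ℝ → ℝ := fun x =>
  if x < c then φ (u * (1 - ((c - x) / c) ^ ρ))
  else ψ (1 + v * (-1 + ((x - c) / (1 - c)) ^ ρ))

/-- The data `(u,v,c,φ,ψ)` of a Cᵏ Lorenz map with critical exponent `ρ > 1`: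
`u,v ∈ (0,1]`, `c ∈ (0,1)`, and `φ, ψ` are Cᵏ orientation-preserving
diffeomorphisms of `[0,1]` fixing `0` and `1`. -/
structure IsLorenz (k : ℕ) (ρ u v c : ℝ) (φ ψ : ℝ → ℝ) : Prop where
  one_lt_rho : 1 < ρ
  u_pos : 0 < u
  u_le_one : u ≤ 1
  v_pos : 0 < v
  v_le_one : v ≤ 1
  c_pos : 0 < c
  c_lt_one : c < 1
  phi_smooth : ContDiffOn ℝ k φ (Icc 0 1)
  psi_smooth : ContDiffOn ℝ k ψ (Icc 0 1)
  phi_zero : φ 0 = 0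
  phi_one : φ 1 = 1
  psi_zero : ψ 0 = 0
  psi_one : ψ 1 = 1
  phi_deriv_pos : ∀ x ∈ Icc (0:ℝ) 1, 0 < derivWithin φ (Icc 0 1) x
  psi_deriv_pos : ∀ x ∈ Icc (0:ℝ) 1, 0 < derivWithin ψ (Icc 0 1) x

/-- `dist[φ] ≤ π`: the distortion bound `log (Dφ(y)/Dφ(x)) ≤ π` for all `x,y ∈ [0,1]`. -/
def DistBound (φ : ℝ → ℝ) (π : ℝ) : Prop :=
  ∀ x ∈ Icc (0:ℝ) 1, ∀ y ∈ Icc (0:ℝ) 1,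
    Real.log (derivWithin φ (Icc 0 1) y / derivWithin φ (Icc 0 1) x) ≤ π

/-- `f = (u,v,c,φ,ψ)` is renormalizable of monotone combinatorial type
`(0 1^n, 1 0^m)` with renormalization intervals `L = [p,c)`, `R = (c,q]`,
`C = [p,q]`: `f^{n+1}` maps `L` into `C` fixing `p`, `f^{m+1}` maps `R` into `C`
fixing `q`, these are first returns (the intermediate iterates of `L` lie in
`(c,1]` and those of `R` in `[0,c)`, all disjoint from `C`), and the rescaled
first return map is a nontrivial Lorenz map (its critical values lie on opposite
sides of its critical point). -/
structure MonotoneRenorm (ρ u v c : ℝ) (φ ψ : ℝ → ℝ) (n m : ℕ) (p q : ℝ) : Prop where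
  n_pos : 1 ≤ n
  m_pos : 1 ≤ m
  p_pos : 0 < p
  p_lt_c : p < c
  c_lt_q : c < q
  q_lt_one : q < 1
  left_return : MapsTo (lorenzF ρ u v c φ ψ)^[n + 1] (Ico p c) (Icc p q)
  left_fix : (lorenzF ρ u v c φ ψ)^[n + 1] p = p
  right_return : MapsTo (lorenzF ρ u v c φ ψ)^[m + 1] (Ioc c q) (Icc p q)
  right_fix : (lorenzF ρ u v c φ ψ)^[m + 1] q = q
  left_iter : ∀ k, 1 ≤ k → k ≤ n →
    (lorenzF ρ u v c φ ψ)^[k] '' Ico p c ⊆ Ioc c 1 ∧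
      Disjoint ((lorenzF ρ u v c φ ψ)^[k] '' Ico p c) (Icc p q)
  right_iter : ∀ k, 1 ≤ k → k ≤ m →
    (lorenzF ρ u v c φ ψ)^[k] '' Ioc c q ⊆ Ico 0 c ∧
      Disjoint ((lorenzF ρ u v c φ ψ)^[k] '' Ioc c q) (Icc p q)
  nontrivial_left : c < (lorenzF ρ u v c φ ψ)^[n] (φ u)
  nontrivial_right : (lorenzF ρ u v c φ ψ)^[m] (ψ (1 - v)) < c

/-- `κ = e^{-π} c / (c₁⁻ ρ)`. -/
noncomputable def kappaC (ρ π c c1m : ℝ) : ℝ := Real.exp (-π) * c / (c1m * ρ)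

/-- `η = e^{-π} μ / ((1-c₁⁺) ρ)`, where `μ = 1 - c`. -/
noncomputable def etaC (ρ π c c1p : ℝ) : ℝ := Real.exp (-π) * (1 - c) / ((1 - c1p) * ρ)

/-- `ν = μ / (1-c₁⁺)^{1/ρ}`. -/
noncomputable def nuC (ρ c c1p : ℝ) : ℝ := (1 - c) / (1 - c1p) ^ (1 / ρ)

/-- `ξ = c / (c₁⁻)^{1/ρ}`. -/
noncomputable def xiC (ρ c c1m : ℝ) : ℝ := c / c1m ^ (1 / ρ)

/-- `γ = e^{2π}/ρ`. -/
noncomputable def gammaC (ρ π : ℝ) : ℝ := Real.exp (2 * π) / ρ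

/-- `Δ = (κ (c/(c-c₁⁺))^{ρ-1} ν^{ρ/(ρ-1)} e^{-π/(ρ-1)})^{ρⁿ/(ρⁿ-1)}`. -/
noncomputable def DeltaC (ρ π c c1m c1p : ℝ) (n : ℕ) : ℝ :=
  (kappaC ρ π c c1m * (c / (c - c1p)) ^ (ρ - 1) * nuC ρ c c1p ^ (ρ / (ρ - 1)) *
      Real.exp (-π / (ρ - 1))) ^ (ρ ^ n / (ρ ^ n - 1))

/-- `Θ = (η (μ/(c₁⁻-c))^{ρ-1} ξ^{ρ/(ρ-1)} e^{-π/(ρ-1)})^{ρᵐ/(ρᵐ-1)}`. -/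
noncomputable def ThetaC (ρ π c c1m c1p : ℝ) (m : ℕ) : ℝ :=
  (etaC ρ π c c1p * ((1 - c) / (c1m - c)) ^ (ρ - 1) * xiC ρ c c1m ^ (ρ / (ρ - 1)) *
      Real.exp (-π / (ρ - 1))) ^ (ρ ^ m / (ρ ^ m - 1))

/-- An increasing homeomorphism of `[0,1]` whose difference quotients over any two subintervals
differ by a factor of at most `E`. -/
structure SecantDistortion (E : ℝ) (φ : ℝ → ℝ) : Prop where
  cont : ContinuousOn φ (Icc 0 1)
  mono : StrictMonoOn φ (Icc 0 1)
  zero : φ 0 = 0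
  one : φ 1 = 1
  secant : ∀ x y s t, 0 ≤ x → x < y → y ≤ 1 → 0 ≤ s → s < t → t ≤ 1 →
    (φ y - φ x) * (t - s) ≤ E * ((φ t - φ s) * (y - x))

theorem SecantDistortion.of_distBound {φ : ℝ → ℝ} {π : ℝ} (hc : ContDiffOn ℝ 1 φ (Icc 0 1))
    (h0 : φ 0 = 0) (h1 : φ 1 = 1) (hpos : ∀ x ∈ Icc (0:ℝ) 1, 0 < derivWithin φ (Icc 0 1) x)
    (hd : DistBound φ π) : SecantDistortion (Real.exp π) φ := by
  have hcont := hc.continuousOn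
  have mvt : ∀ x y, 0 ≤ x → x < y → y ≤ 1 →
      ∃ ξ ∈ Icc (0:ℝ) 1, φ y - φ x = derivWithin φ (Icc 0 1) ξ * (y - x) := by
    intro x y hx hxy hy
    have hdiff : DifferentiableOn ℝ φ (Ioo x y) :=
      (hc.differentiableOn (by norm_num)).mono fun z hz =>
        ⟨hx.trans hz.1.le, hz.2.le.trans hy⟩
    obtain ⟨ξ, hξ, h⟩ := exists_deriv_eq_slope φ hxy
      (hcont.mono (Icc_subset_Icc hx hy)) hdiff
    refine ⟨ξ, ⟨hx.trans hξ.1.le, hξ.2.le.trans hy⟩, ?_⟩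
    rw [derivWithin_of_mem_nhds (Icc_mem_nhds (hx.trans_lt hξ.1) (hξ.2.trans_le hy)), h,
      div_mul_cancel₀ _ (sub_pos.2 hxy).ne']
  refine ⟨hcont, ?_, h0, h1, ?_⟩
  · intro x hx y hy hxy
    obtain ⟨ξ, hξ, h⟩ := mvt x y hx.1 hxy hy.2
    have := mul_pos (hpos ξ hξ) (sub_pos.2 hxy)
    linarith
  · intro x y s t hx hxy hy hs hst ht
    obtain ⟨ξ, hξ, h⟩ := mvt x y hx hxy hy
    obtain ⟨η, hη, h'⟩ := mvt s t hs hst ht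
    have hle : derivWithin φ (Icc 0 1) ξ ≤ Real.exp π * derivWithin φ (Icc 0 1) η := by
      have := hd η hη ξ hξ
      rwa [Real.log_le_iff_le_exp (div_pos (hpos ξ hξ) (hpos η hη)),
        div_le_iff₀ (hpos η hη)] at this
    rw [h, h']
    have := mul_le_mul_of_nonneg_right hle
      (mul_pos (sub_pos.2 hxy) (sub_pos.2 hst)).le
    linarith

theorem SecantDistortion.reflect {E : ℝ} {φ : ℝ → ℝ} (h : SecantDistortion E φ) :
    SecantDistortion E (fun x => 1 - φ (1 - x)) := by
  have hmaps : MapsTo (fun x : ℝ => 1 - x) (Icc 0 1) (Icc 0 1) := fun x hx =>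
    ⟨by linarith [hx.2], by linarith [hx.1]⟩
  refine ⟨continuousOn_const.sub (h.cont.comp (by fun_prop) hmaps), ?_, by simp [h.one],
    by simp [h.zero], ?_⟩
  · intro x hx y hy hxy
    have := h.mono (hmaps hy) (hmaps hx) (show 1 - y < 1 - x by linarith)
    simp only
    linarith
  · intro x y s t hx hxy hy hs hst ht
    have := h.secant (1 - y) (1 - x) (1 - t) (1 - s) (by linarith) (by linarith) (by linarith)
      (by linarith) (by linarith) (by linarith)
    calc _ = (φ (1 - x) - φ (1 - y)) * (1 - s - (1 - t)) := by ring
      _ ≤ _ := this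
      _ = _ := by ring

/-- The right branch of a Lorenz map. -/
noncomputable def rightBranch (ρ v c : ℝ) (ψ : ℝ → ℝ) (x : ℝ) : ℝ :=
  ψ (1 + v * (-1 + ((x - c) / (1 - c)) ^ ρ))

theorem rightBranch_arg_mem {ρ v c x : ℝ} (hρ : 1 < ρ) (hv : 0 < v) (hv1 : v ≤ 1) (hc1 : c < 1)
    (hx : c ≤ x) (hx1 : x ≤ 1) : 1 + v * (-1 + ((x - c) / (1 - c)) ^ ρ) ∈ Icc (0:ℝ) 1 := by
  have hμ : 0 < 1 - c := by linarith
  have hz0 : 0 ≤ (x - c) / (1 - c) := div_nonneg (by linarith) hμ.le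
  have hz1 : (x - c) / (1 - c) ≤ 1 := by rw [div_le_one hμ]; linarith
  have h0 := Real.rpow_nonneg hz0 ρ
  have h1 := Real.rpow_le_one hz0 hz1 (by linarith : 0 ≤ ρ)
  constructor <;> nlinarith

theorem rightBranch_strictMonoOn {ρ v c E : ℝ} {ψ : ℝ → ℝ} (hρ : 1 < ρ) (hv : 0 < v) (hv1 : v ≤ 1)
    (hc1 : c < 1) (hψ : SecantDistortion E ψ) :
    StrictMonoOn (rightBranch ρ v c ψ) (Icc c 1) := by
  intro x hx y hy hxy
  have hμ : 0 < 1 - c := by linarith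
  refine hψ.mono (rightBranch_arg_mem hρ hv hv1 hc1 hx.1 hx.2)
    (rightBranch_arg_mem hρ hv hv1 hc1 hy.1 hy.2) ?_
  have : ((x - c) / (1 - c)) ^ ρ < ((y - c) / (1 - c)) ^ ρ := by
    apply Real.rpow_lt_rpow (div_nonneg (by linarith [hx.1]) hμ.le) _ (by linarith)
    gcongr
  nlinarith

/-- Expansion of the right branch relative to the distances to `c` and to the critical value. -/
theorem rightBranch_expansion {ρ v c E a b : ℝ} {ψ : ℝ → ℝ} (hρ : 1 < ρ) (hv : 0 < v)
    (hv1 : v ≤ 1) (hc1 : c < 1) (hψ : SecantDistortion E ψ) (ha : c < a) (hab : a < b)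
    (hb : b ≤ 1) :
    ρ * (rightBranch ρ v c ψ a - ψ (1 - v)) * (b - a) ≤
      E * ((rightBranch ρ v c ψ b - rightBranch ρ v c ψ a) * (a - c)) := by
  have hμ : 0 < 1 - c := by linarith
  have hQa := rightBranch_arg_mem hρ hv hv1 hc1 ha.le (hab.le.trans hb)
  have hQb := rightBranch_arg_mem hρ hv hv1 hc1 (ha.trans hab).le hb
  unfold rightBranch
  set z := ((a - c) / (1 - c)) ^ ρ with hz
  set w := ((b - c) / (1 - c)) ^ ρ with hw
  have hac : 0 < a - c := by linarith
  have hzpos : 0 < z := Real.rpow_pos_of_pos (div_pos hac hμ) ρ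
  have hbern : 1 + ρ * ((b - a) / (a - c)) ≤ (1 + (b - a) / (a - c)) ^ ρ :=
    one_add_mul_self_le_rpow_one_add
      (by linarith [div_pos (sub_pos.2 hab) hac]) hρ.le
  have hwz : w = z * (1 + (b - a) / (a - c)) ^ ρ := by
    rw [hz, hw, ← Real.mul_rpow (div_pos hac hμ).le
      (by linarith [div_pos (sub_pos.2 hab) hac])]
    congr 1
    field_simp
    ring
  have hgrow : ρ * z * (b - a) ≤ (w - z) * (a - c) := by
    have h1 : z * (ρ * ((b - a) / (a - c))) ≤ w - z := by
      rw [hwz]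
      nlinarith
    have h2 := mul_le_mul_of_nonneg_right h1 hac.le
    calc ρ * z * (b - a) = z * (ρ * ((b - a) / (a - c))) * (a - c) := by field_simp
      _ ≤ _ := h2
  have hzw : z < w := by
    have : 0 < ρ * z * (b - a) := mul_pos (mul_pos (by linarith) hzpos) (sub_pos.2 hab)
    have := pos_of_mul_pos_left (this.trans_le hgrow) hac.le
    linarith
  have hsec := hψ.secant (1 - v) (1 + v * (-1 + z)) (1 + v * (-1 + z)) (1 + v * (-1 + w))
    (by linarith) (by nlinarith) hQa.2 hQa.1 (by nlinarith) hQb.2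
  have hm : ψ (1 - v) ≤ ψ (1 + v * (-1 + z)) :=
    hψ.mono.monotoneOn ⟨by linarith, by linarith⟩ hQa (by nlinarith)
  set X := ψ (1 + v * (-1 + z)) - ψ (1 - v) with hX
  set Y := ψ (1 + v * (-1 + w)) - ψ (1 + v * (-1 + z)) with hY
  have hsec' : X * (w - z) ≤ E * (Y * z) := by
    have : v * (X * (w - z)) ≤ v * (E * (Y * z)) := by linarith
    exact le_of_mul_le_mul_left this hv
  have hX0 : 0 ≤ X := by linarith
  have : z * (ρ * X * (b - a)) ≤ z * (E * (Y * (a - c))) := by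
    calc z * (ρ * X * (b - a)) = X * (ρ * z * (b - a)) := by ring
      _ ≤ X * ((w - z) * (a - c)) := mul_le_mul_of_nonneg_left hgrow hX0
      _ = X * (w - z) * (a - c) := by ring
      _ ≤ E * (Y * z) * (a - c) := mul_le_mul_of_nonneg_right hsec' hac.le
      _ = _ := by ring
  exact le_of_mul_le_mul_left this hzpos

theorem sum_gap_le (a b : ℕ → ℝ) (N : ℕ) (h : ∀ k < N, b (k + 1) ≤ a k) :
    ∑ j ∈ Finset.range (N + 1), (b j - a j) ≤ b 0 - a N := by
  induction N with
  | zero => simp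
  | succ N ih =>
    rw [Finset.sum_range_succ]
    have := ih fun k hk => h k (by omega)
    have := h N (by omega)
    linarith

/-- Along two orbits `a < b` of the right branch staying in `(c,1]`, the gaps grow at least
geometrically, up to the factor `d`. -/
theorem gap_growth {ρ v c E d : ℝ} {ψ : ℝ → ℝ} (hρ : 1 < ρ) (hv : 0 < v) (hv1 : v ≤ 1)
    (hc : 0 < c) (hc1 : c < 1) (hE : 0 < E) (hψ : SecantDistortion E ψ) (hd1 : d ≤ 1)
    (hd : ψ (1 - v) ≤ c - d) (hd0 : 0 ≤ d) (a b : ℕ → ℝ) (N : ℕ)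
    (ha : ∀ k ≤ N, a k ∈ Ioc c 1) (hb : ∀ k ≤ N, b k ∈ Ioc c 1) (hab : a 0 < b 0)
    (hastep : ∀ k < N, a (k + 1) = rightBranch ρ v c ψ (a k))
    (hbstep : ∀ k < N, b (k + 1) = rightBranch ρ v c ψ (b k)) :
    ∀ j ≤ N, (ρ / E) ^ j * (d * (b 0 - a 0)) ≤ b j - a j := by
  have key : ∀ j ≤ N, a j < b j ∧
      ρ ^ j * (b 0 - a 0) * (a j - c) ≤ E ^ j * (b j - a j) * (a 0 - c) ∧
      ρ ^ j * (d * (b 0 - a 0)) ≤ E ^ j * (b j - a j) := by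
    intro j
    induction j with
    | zero =>
      intro _
      refine ⟨hab, by simp, ?_⟩
      simp only [pow_zero, one_mul]
      nlinarith
    | succ j ih =>
      intro hj
      obtain ⟨hlt, hI, -⟩ := ih (by omega)
      have haj := ha j (by omega)
      have hbj := hb j (by omega)
      have haj1 := ha (j + 1) hj
      have ha0 := ha 0 (by omega)
      have hlt' : a (j + 1) < b (j + 1) := by
        rw [hastep j (by omega), hbstep j (by omega)]
        exact rightBranch_strictMonoOn hρ hv hv1 hc1 hψ (Ioc_subset_Icc_self haj)
          (Ioc_subset_Icc_self hbj) hlt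
      have hexp := rightBranch_expansion hρ hv hv1 hc1 hψ haj.1 hlt hbj.2
      rw [← hastep j (by omega), ← hbstep j (by omega)] at hexp
      have hajc : 0 < a j - c := by linarith [haj.1]
      have hgap : d ≤ a (j + 1) - ψ (1 - v) := by linarith [haj1.1]
      have hJ : ρ ^ (j + 1) * (b 0 - a 0) * (a (j + 1) - ψ (1 - v)) ≤
          E ^ (j + 1) * (b (j + 1) - a (j + 1)) * (a 0 - c) := by
        refine le_of_mul_le_mul_right ?_ hajc
        calc _ = ρ * (a (j + 1) - ψ (1 - v)) * (ρ ^ j * (b 0 - a 0) * (a j - c)) := by ring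
          _ ≤ ρ * (a (j + 1) - ψ (1 - v)) * (E ^ j * (b j - a j) * (a 0 - c)) :=
            mul_le_mul_of_nonneg_left hI (mul_nonneg (by linarith) (by linarith))
          _ = E ^ j * (a 0 - c) * (ρ * (a (j + 1) - ψ (1 - v)) * (b j - a j)) := by ring
          _ ≤ E ^ j * (a 0 - c) * (E * ((b (j + 1) - a (j + 1)) * (a j - c))) :=
            mul_le_mul_of_nonneg_left hexp
              (mul_nonneg (pow_nonneg hE.le _) (by linarith [ha0.1]))
          _ = _ := by ring
      have hpos : 0 ≤ ρ ^ (j + 1) * (b 0 - a 0) :=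
        mul_nonneg (pow_nonneg (by linarith) _) (by linarith)
      refine ⟨hlt', le_trans (mul_le_mul_of_nonneg_left (by linarith) hpos) hJ, ?_⟩
      calc _ = ρ ^ (j + 1) * (b 0 - a 0) * d := by ring
        _ ≤ ρ ^ (j + 1) * (b 0 - a 0) * (a (j + 1) - ψ (1 - v)) :=
          mul_le_mul_of_nonneg_left hgap hpos
        _ ≤ _ := hJ
        _ ≤ E ^ (j + 1) * (b (j + 1) - a (j + 1)) * 1 :=
          mul_le_mul_of_nonneg_left (by linarith [ha0.2])
            (mul_nonneg (pow_nonneg hE.le _) (by linarith))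
        _ = _ := mul_one _
  intro j hj
  rw [div_pow, div_mul_eq_mul_div, div_le_iff₀ (pow_pos hE j)]
  linarith [(key j hj).2.2]

/-- The bound on the left central interval, in terms of the orbits `a x` of the points `x ∈ [p,c)`
(shifted so that `a x 0` is the first image of `x`). -/
theorem left_interval_bound {ρ u v c E p q : ℝ} {φ ψ : ℝ → ℝ} (hρ : 1 < ρ) (hu : 0 < u)
    (hu1 : u ≤ 1) (hv : 0 < v) (hv1 : v ≤ 1) (hc : 0 < c) (hc1 : c < 1) (hE : 1 ≤ E)
    (hEρ : E ^ 2 < ρ) (hφ : SecantDistortion E φ) (hψ : SecantDistortion E ψ)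
    (hp : 0 < p) (hpc : p < c) (N : ℕ) (a : ℝ → ℕ → ℝ)
    (hfirst : ∀ x ∈ Ico p c, a x 0 = φ (u * (1 - ((c - x) / c) ^ ρ)))
    (hstep : ∀ x ∈ Ico p c, ∀ k ≤ N, a x (k + 1) = rightBranch ρ v c ψ (a x k))
    (hmem : ∀ x ∈ Ico p c, ∀ k ≤ N, a x k ∈ Ioc c 1)
    (hq : q < a p N) (hlast : ∀ x ∈ Ico p c, a x (N + 1) ≤ q)
    (hcrit : ψ (1 - v) ≤ p) :
    c - p ≤ ((φ u - c) * c ^ ρ * E / φ u) ^ (1 / (ρ + 1)) *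
      ((ρ / E ^ 2 - 1) / ((ρ / E ^ 2) ^ (N + 1) - 1)) ^ (1 / (ρ + 1)) := by
  have hE0 : 0 < E := by linarith
  have hpmem : p ∈ Ico p c := ⟨le_rfl, hpc⟩
  have hargle : ∀ x ∈ Icc p c, u * (1 - ((c - x) / c) ^ ρ) ∈ Icc 0 u := by
    intro x hx
    have hz0 : 0 ≤ (c - x) / c := div_nonneg (by linarith [hx.2]) hc.le
    have hz1 : (c - x) / c ≤ 1 := by rw [div_le_one hc]; linarith [hx.1]
    have h0 := Real.rpow_nonneg hz0 ρ
    have h1 := Real.rpow_le_one hz0 hz1 (by linarith : 0 ≤ ρ)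
    constructor <;> nlinarith
  have harg : ∀ x ∈ Icc p c, u * (1 - ((c - x) / c) ^ ρ) ∈ Icc (0:ℝ) 1 := fun x hx =>
    ⟨(hargle x hx).1, (hargle x hx).2.trans hu1⟩
  have humem : u ∈ Icc (0:ℝ) 1 := ⟨hu.le, hu1⟩
  have hfirst_le : ∀ x ∈ Ico p c, a x 0 ≤ φ u := by
    intro x hx
    rw [hfirst x hx]
    exact hφ.mono.monotoneOn (harg x (Ico_subset_Icc_self hx)) humem
      (hargle x (Ico_subset_Icc_self hx)).2
  have hφuc : c < φ u := (hmem p hpmem 0 (by omega)).1.trans_le (hfirst_le p hpmem)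
  set G := ρ / E ^ 2 with hG
  have hG1 : 1 < G := by rw [hG, one_lt_div (by positivity)]; exact hEρ
  set S := ∑ j ∈ Finset.range (N + 1), G ^ j with hS
  have hSpos : 0 < S := Finset.sum_pos (fun j _ => pow_pos (by linarith) j) (by simp)
  have hGle : G ≤ ρ / E := by
    rw [hG]
    gcongr
    nlinarith
  have horb : ∀ x ∈ Ico p c, S * (c - p) * (a x 0 - a p 0) ≤ φ u - c := by
    intro x hx
    rcases le_or_gt (a x 0) (a p 0) with hle | hlt
    · have : S * (c - p) * (a x 0 - a p 0) ≤ 0 :=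
        mul_nonpos_of_nonneg_of_nonpos (mul_nonneg hSpos.le (by linarith)) (by linarith)
      linarith
    have hgrow := gap_growth (d := c - p) hρ hv hv1 hc hc1 hE0 hψ (by linarith) (by linarith)
      (by linarith) (a p) (a x) N (hmem p hpmem) (hmem x hx) hlt
      (fun k hk => hstep p hpmem k hk.le) (fun k hk => hstep x hx k hk.le)
    have hdisj : ∀ i ≤ N, a x (N - i + 1) ≤ a p (N - i) := by
      intro i
      induction i with
      | zero => intro _; exact (hlast x hx).trans hq.le
      | succ i ih =>
        intro hi
        have h := ih (by omega)
        have e : N - i = N - (i + 1) + 1 := by omega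
        rw [e, hstep x hx _ (by omega), hstep p hpmem _ (by omega)] at h
        exact ((rightBranch_strictMonoOn hρ hv hv1 hc1 hψ).le_iff_le
          (Ioc_subset_Icc_self (hmem x hx _ (by omega)))
          (Ioc_subset_Icc_self (hmem p hpmem _ (by omega)))).1 h
    have hsum := sum_gap_le (a p) (a x) N fun k hk => by
      have := hdisj (N - k) (by omega)
      rwa [Nat.sub_sub_self hk.le] at this
    have hlow : S * ((c - p) * (a x 0 - a p 0)) ≤
        ∑ j ∈ Finset.range (N + 1), (a x j - a p j) := by
      rw [hS, Finset.sum_mul]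
      refine Finset.sum_le_sum fun j hj => le_trans ?_ (hgrow j (by simp at hj; omega))
      exact mul_le_mul_of_nonneg_right (pow_le_pow_left₀ (by linarith) hGle j)
        (mul_nonneg (by linarith) (by linarith))
    have := (hmem p hpmem N le_rfl).1
    have := hfirst_le x hx
    linarith
  have hlim : S * (c - p) * (φ u - a p 0) ≤ φ u - c := by
    have hcl : closure (Ico p c) = Icc p c := closure_Ico hpc.ne
    have hF : ContinuousOn (fun x => φ (u * (1 - ((c - x) / c) ^ ρ))) (Icc p c) := by
      refine hφ.cont.comp (Continuous.continuousOn ?_) harg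
      refine continuous_const.mul (continuous_const.sub ?_)
      exact Continuous.rpow_const (by fun_prop) fun _ => Or.inr (by linarith)
    have := le_on_closure (s := Ico p c)
      (f := fun x => S * (c - p) * (φ (u * (1 - ((c - x) / c) ^ ρ)) - a p 0))
      (g := fun _ => φ u - c) (fun x hx => by simpa [hfirst x hx] using horb x hx)
      (by rw [hcl]; exact continuousOn_const.mul (hF.sub continuousOn_const))
      continuousOn_const (x := c) (by rw [hcl]; exact ⟨hpc.le, le_rfl⟩)
    simpa [Real.zero_rpow (by linarith : ρ ≠ 0)] using this
  have hφu : 0 < φ u := by linarith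
  set t := ((c - p) / c) ^ ρ with ht
  have htpos : 0 < t := Real.rpow_pos_of_pos (div_pos (by linarith) hc) ρ
  have hfirstgap : φ u * t ≤ E * (φ u - a p 0) := by
    have hs := hφ.secant 0 u (u * (1 - t)) u le_rfl hu hu1 (harg p ⟨le_rfl, hpc.le⟩).1
      (by nlinarith) hu1
    rw [hφ.zero, ← hfirst p hpmem] at hs
    refine le_of_mul_le_mul_left ?_ hu
    linarith
  have hcρ : 0 < c ^ ρ := Real.rpow_pos_of_pos hc ρ
  have hd : 0 < c - p := by linarith
  have hmain : (c - p) ^ (ρ + 1) ≤ (φ u - c) * c ^ ρ * E / φ u * (1 / S) := by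
    have htc : t * c ^ ρ = (c - p) ^ ρ := by
      rw [ht, Real.div_rpow hd.le hc.le, div_mul_cancel₀ _ hcρ.ne']
    rw [mul_one_div, div_div, le_div_iff₀ (mul_pos hφu hSpos), Real.rpow_add hd,
      Real.rpow_one, ← htc]
    calc _ = S * (c - p) * c ^ ρ * (φ u * t) := by ring
      _ ≤ S * (c - p) * c ^ ρ * (E * (φ u - a p 0)) :=
        mul_le_mul_of_nonneg_left hfirstgap (by positivity)
      _ = c ^ ρ * E * (S * (c - p) * (φ u - a p 0)) := by ring
      _ ≤ c ^ ρ * E * (φ u - c) := mul_le_mul_of_nonneg_left hlim (by positivity)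
      _ = _ := by ring
  have hratio : (G - 1) / (G ^ (N + 1) - 1) = 1 / S := by
    rw [hS, geom_sum_eq hG1.ne', one_div_div]
  rw [hratio, ← Real.mul_rpow (div_nonneg (mul_nonneg (mul_nonneg (by linarith) hcρ.le) hE0.le)
    hφu.le) (by positivity)]
  calc c - p = ((c - p) ^ (ρ + 1)) ^ (1 / (ρ + 1)) := by
        rw [one_div, Real.rpow_rpow_inv hd.le (by linarith)]
    _ ≤ _ := Real.rpow_le_rpow (Real.rpow_nonneg hd.le _) hmain
      (one_div_nonneg.2 (by linarith))

/-- First upper bounds on the central intervals `L = [p,c)`, `R = (c,q]` of a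
renormalizable Lorenz map of monotone type, with `0 < 2π < log ρ`:
`|L| ≤ ((c₁⁻-c) c^ρ e^π/c₁⁻)^{1/(ρ+1)} ((γ⁻¹-1)/(γ⁻ⁿ-1))^{1/(ρ+1)}` and
`|R| ≤ ((c-c₁⁺) μ^ρ e^π/(1-c₁⁺))^{1/(ρ+1)} ((γ⁻¹-1)/(γ⁻ᵐ-1))^{1/(ρ+1)}`. -/
theorem central_interval_upper_bounds_one (ρ u v c π : ℝ) (φ ψ : ℝ → ℝ)
    (n m : ℕ) (p q : ℝ)
    (hL : IsLorenz 1 ρ u v c φ ψ) (hπ : 0 < π) (hπρ : 2 * π < Real.log ρ)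
    (hφd : DistBound φ π) (hψd : DistBound ψ π)
    (hren : MonotoneRenorm ρ u v c φ ψ n m p q) :
    c - p ≤ ((φ u - c) * c ^ ρ * Real.exp π / φ u) ^ (1 / (ρ + 1)) *
        (((gammaC ρ π)⁻¹ - 1) / ((gammaC ρ π)⁻¹ ^ n - 1)) ^ (1 / (ρ + 1)) ∧
      q - c ≤ ((c - ψ (1 - v)) * (1 - c) ^ ρ * Real.exp π / (1 - ψ (1 - v))) ^
          (1 / (ρ + 1)) *
        (((gammaC ρ π)⁻¹ - 1) / ((gammaC ρ π)⁻¹ ^ m - 1)) ^ (1 / (ρ + 1)) := by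
  have hφ := SecantDistortion.of_distBound hL.phi_smooth hL.phi_zero hL.phi_one
    hL.phi_deriv_pos hφd
  have hψ := SecantDistortion.of_distBound hL.psi_smooth hL.psi_zero hL.psi_one
    hL.psi_deriv_pos hψd
  obtain ⟨hρ, hu, hu1, hv, hv1, hc, hc1⟩ := hL
  obtain ⟨hn, hm, hp, hpc, hcq, hq1, hleft, -, hright, -, hli, hri, -, -⟩ := hren
  obtain ⟨N, rfl⟩ : ∃ N, n = N + 1 := ⟨n - 1, by omega⟩
  obtain ⟨M, rfl⟩ : ∃ M, m = M + 1 := ⟨m - 1, by omega⟩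
  have hμ : 0 < 1 - c := by linarith
  have hE : 1 ≤ Real.exp π := Real.one_le_exp hπ.le
  have hexp : Real.exp (2 * π) = Real.exp π ^ 2 := by
    rw [← Real.exp_nat_mul]; norm_num
  have hEρ : Real.exp π ^ 2 < ρ := by
    rw [← hexp]; exact (Real.lt_log_iff_exp_lt (by linarith)).1 hπρ
  have hγ : (gammaC ρ π)⁻¹ = ρ / Real.exp π ^ 2 := by
    rw [gammaC, inv_div, hexp]
  have hpmem : p ∈ Ico p c := ⟨le_rfl, hpc⟩
  have hqmem : q ∈ Ioc c q := ⟨hcq, le_rfl⟩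
  set f := lorenzF ρ u v c φ ψ with hf
  have hfl : ∀ x, x < c → f x = φ (u * (1 - ((c - x) / c) ^ ρ)) := fun x hx => by
    simp [hf, lorenzF, hx]
  have hfr : ∀ x, c < x → f x = rightBranch ρ v c ψ x := fun x hx => by
    simp [hf, lorenzF, rightBranch, hx.not_gt]
  have hlmem : ∀ x ∈ Ico p c, ∀ k ≤ N, f^[k + 1] x ∈ Ioc c 1 := fun x hx k hk =>
    (hli (k + 1) (by omega) (by omega)).1 (mem_image_of_mem _ hx)
  have hrmem : ∀ x ∈ Ioc c q, ∀ k ≤ M, f^[k + 1] x ∈ Ico 0 c := fun x hx k hk =>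
    (hri (k + 1) (by omega) (by omega)).1 (mem_image_of_mem _ hx)
  have hlq : ∀ k ≤ N, q < f^[k + 1] p := fun k hk => by
    by_contra! h
    exact disjoint_left.1 (hli (k + 1) (by omega) (by omega)).2 (mem_image_of_mem _ hpmem)
      ⟨hpc.le.trans (hlmem p hpmem k hk).1.le, h⟩
  have hrp : ∀ k ≤ M, f^[k + 1] q < p := fun k hk => by
    by_contra! h
    exact disjoint_left.1 (hri (k + 1) (by omega) (by omega)).2 (mem_image_of_mem _ hqmem)
      ⟨h, (hrmem q hqmem k hk).2.le.trans hcq.le⟩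
  have hcritr : ψ (1 - v) ≤ p := by
    refine le_trans ?_ (hrp 0 (by omega)).le
    rw [zero_add, Function.iterate_one, hfr q hcq]
    refine hψ.mono.monotoneOn ⟨by linarith, by linarith⟩
      (rightBranch_arg_mem hρ hv hv1 hc1 hcq.le hq1.le) ?_
    have := Real.rpow_nonneg (div_nonneg (sub_nonneg.2 hcq.le) hμ.le) ρ
    nlinarith
  have hcritl : q ≤ φ u := by
    refine (hlq 0 (by omega)).le.trans ?_
    rw [zero_add, Function.iterate_one, hfl p hpc]
    have hz0 : 0 ≤ (c - p) / c := div_nonneg (by linarith) hc.le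
    have hz1 : (c - p) / c ≤ 1 := by rw [div_le_one hc]; linarith
    have h0 := Real.rpow_nonneg hz0 ρ
    have h1 := Real.rpow_le_one hz0 hz1 (by linarith : 0 ≤ ρ)
    exact hφ.mono.monotoneOn ⟨by nlinarith, by nlinarith⟩ ⟨hu.le, hu1⟩ (by nlinarith)
  rw [hγ]
  constructor
  · refine left_interval_bound hρ hu hu1 hv hv1 hc hc1 hE hEρ hφ hψ hp hpc N
      (fun x k => f^[k + 1] x) (fun x hx => ?_) (fun x hx k hk => ?_) hlmem (hlq N le_rfl)
      (fun x hx => (hleft hx).2) hcritr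
    · simpa using hfl x hx.2
    · simp only [Function.iterate_succ_apply' f (k + 1)]
      exact hfr _ (hlmem x hx k hk).1
  · have hflip : ∀ x ∈ Ico (1 - q) (1 - c), 1 - x ∈ Ioc c q := fun x hx =>
      ⟨by linarith [hx.2], by linarith [hx.1]⟩
    have key := left_interval_bound (c := 1 - c) (p := 1 - q) (q := 1 - p) hρ hv hv1 hu hu1 hμ
      (by linarith) hE hEρ hψ.reflect hφ.reflect (by linarith) (by linarith) M
      (fun x k => 1 - f^[k + 1] (1 - x)) (fun x hx => ?_) (fun x hx k hk => ?_)
      (fun x hx k hk => ?_) ?_ (fun x hx => ?_) ?_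
    · convert key using 1
      · ring
      · congr 3
        ring
    · simp only [zero_add, Function.iterate_one, hfr _ (hflip x hx).1, rightBranch]
      ring_nf
    · simp only [Function.iterate_succ_apply' f (k + 1)]
      rw [hfl _ (hrmem _ (hflip x hx) k hk).2, rightBranch]
      ring_nf
    · have := hrmem _ (hflip x hx) k hk
      exact ⟨by linarith [this.2], by linarith [this.1]⟩
    · have := hrp M le_rfl
      simp only [sub_sub_cancel]
      linarith
    · have := (hright (hflip x hx)).1
      linarith
    · simp only [sub_sub_cancel]
      linarith
end

section
/- Let 0 < 2π < ln ρ. There exists a constant K > 0 such that for every C^1 Lorenz map f ∈ K^π renormalizable of monotone combinatorial type (0 1^n, 1 0^m) with central intervals L=[p,c), R=(c,q], one has |L| ≥ ( e^{−π}·c^ρ·η^n / c_1^− )^{1/(ρ−1)} · exp( K·(η^n·Θ/(μ(1−η^n)))·Σ_{k=1}^{n} ( (e^{−2π}/η)·((Θ+|R|)/μ)^{ρ−1} )^{k−1} ) and |R| ≥ ( e^{−π}·μ^ρ·κ^m / (1−c_1^+) )^{1/(ρ−1)} · exp( K·(κ^m·Δ/(c(1−κ^m)))·Σ_{k=1}^{m}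 ( (e^{−2π}/κ)·((Δ+|L|)/c)^{ρ−1} )^{k−1} ). -/
open Set

/-- If `F` and `G` agree along the `F`-orbit of `y` up to time `k`, their `k`-th iterates agree
at `y`. -/
theorem iterate_eq_of_eq_on_orbit {α : Type*} {F G : α → α} {y : α} :
    ∀ k : ℕ, (∀ j < k, F (F^[j] y) = G (F^[j] y)) → F^[k] y = G^[k] y
  | 0, _ => rfl
  | k + 1, h => by
    rw [Function.iterate_succ_apply', Function.iterate_succ_apply',
      ← iterate_eq_of_eq_on_orbit k fun j hj => h j (by omega)]
    exact h k (by omega)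

theorem iterate_one_sub (g : ℝ → ℝ) (k : ℕ) (x : ℝ) :
    (fun t => 1 - g (1 - t))^[k] (1 - x) = 1 - g^[k] x := by
  induction k with
  | zero => rfl
  | succ k ih => simp only [Function.iterate_succ_apply', ih, sub_sub_cancel]

/-- Comparison of orbits under a map that is increasing on `[c,1]`. -/
theorem iterate_le_iterate_of_monotoneOn {g : ℝ → ℝ} {c x y : ℝ}
    (hg : MonotoneOn g (Icc c 1)) (h1 : g 1 = 1) (hc : c ≤ 1) (hyx : y ≤ x) (hx : x ≤ 1) :
    ∀ k : ℕ, (∀ j < k, c ≤ g^[j] y) → g^[k] y ≤ g^[k] x ∧ g^[k] x ≤ 1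
  | 0, _ => ⟨hyx, hx⟩
  | k + 1, h => by
    obtain ⟨h2, h3⟩ :=
      iterate_le_iterate_of_monotoneOn hg h1 hc hyx hx k fun j hj => h j (by omega)
    have h4 := h k (by omega)
    simp only [Function.iterate_succ_apply']
    refine ⟨hg ⟨h4, h2.trans h3⟩ ⟨h4.trans h2, h3⟩ h2, ?_⟩
    exact (hg ⟨h4.trans h2, h3⟩ ⟨hc, le_rfl⟩ h3).trans_eq h1

/-- Comparison of orbits under a map that is increasing on `[0,c]`. -/
theorem iterate_le_iterate_of_monotoneOn_left {f : ℝ → ℝ} {c x y : ℝ}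
    (hf : MonotoneOn f (Icc 0 c)) (h0 : f 0 = 0) (hc : 0 ≤ c) (hxy : x ≤ y) (hx : 0 ≤ x) :
    ∀ k : ℕ, (∀ j < k, f^[j] y ≤ c) → f^[k] x ≤ f^[k] y ∧ 0 ≤ f^[k] x
  | 0, _ => ⟨hxy, hx⟩
  | k + 1, h => by
    obtain ⟨h2, h3⟩ :=
      iterate_le_iterate_of_monotoneOn_left hf h0 hc hxy hx k fun j hj => h j (by omega)
    have h4 := h k (by omega)
    simp only [Function.iterate_succ_apply']
    refine ⟨hf ⟨h3, h2.trans h4⟩ ⟨h3.trans h2, h4⟩ h2, ?_⟩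
    exact h0.symm.trans_le (hf ⟨le_rfl, hc⟩ ⟨h3, h2.trans h4⟩ h3)

/-- Tangent-line inequality for `t ↦ t ^ ρ`. -/
theorem rpow_sub_rpow_le {ρ s t : ℝ} (hρ : 1 < ρ) (ht : 0 ≤ t) (hts : t ≤ s) :
    s ^ ρ - t ^ ρ ≤ ρ * s ^ (ρ - 1) * (s - t) := by
  rcases (ht.trans hts).eq_or_lt with h | hs
  · obtain rfl : t = 0 := by linarith
    subst h
    simp
  have h1 : -1 ≤ t / s - 1 := by linarith [div_nonneg ht hs.le]
  have h2 := one_add_mul_self_le_rpow_one_add h1 hρ.le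
  rw [show 1 + (t / s - 1) = t / s by ring, Real.div_rpow ht hs.le,
    le_div_iff₀ (Real.rpow_pos_of_pos hs ρ)] at h2
  have h3 : s ^ ρ = s ^ (ρ - 1) * s := by
    rw [← Real.rpow_add_one hs.ne']; ring_nf
  have h4 : (1 + ρ * (t / s - 1)) * s ^ ρ = s ^ ρ - ρ * s ^ (ρ - 1) * (s - t) := by
    rw [h3]; field_simp; ring
  linarith

/-- Mean value theorem on `[0,1]` with one-sided derivatives at the end points. -/
theorem exists_derivWithin_mul_sub {φ : ℝ → ℝ} (hφ : ContDiffOn ℝ 1 φ (Icc 0 1)) {s t : ℝ}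
    (hs : 0 ≤ s) (hst : s ≤ t) (ht : t ≤ 1) :
    ∃ x ∈ Icc (0 : ℝ) 1, φ t - φ s = derivWithin φ (Icc 0 1) x * (t - s) := by
  rcases hst.eq_or_lt with rfl | hlt
  · exact ⟨s, ⟨hs, ht⟩, by simp⟩
  have hd : ∀ x ∈ Ioo s t, HasDerivAt φ (derivWithin φ (Icc 0 1) x) x := fun x hx =>
    ((hφ.differentiableOn one_ne_zero) x
      ⟨hs.trans hx.1.le, hx.2.le.trans ht⟩).hasDerivWithinAt.hasDerivAt
      (Icc_mem_nhds (hs.trans_lt hx.1) (hx.2.trans_le ht))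
  obtain ⟨x, hx, h⟩ := exists_hasDerivAt_eq_slope φ (derivWithin φ (Icc 0 1)) hlt
    (hφ.continuousOn.mono (Icc_subset_Icc hs ht)) hd
  refine ⟨x, ⟨hs.trans hx.1.le, hx.2.le.trans ht⟩, ?_⟩
  rw [h, div_mul_cancel₀ _ (sub_pos.2 hlt).ne']

theorem monotoneOn_of_derivWithin_pos {φ : ℝ → ℝ} (hφ : ContDiffOn ℝ 1 φ (Icc 0 1))
    (hd : ∀ x ∈ Icc (0 : ℝ) 1, 0 < derivWithin φ (Icc 0 1) x) : MonotoneOn φ (Icc 0 1) := by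
  intro s hs t ht hst
  obtain ⟨x, hx, h⟩ := exists_derivWithin_mul_sub hφ hs.1 hst ht.2
  nlinarith [mul_nonneg (hd x hx).le (sub_nonneg.2 hst)]

/-- Bounded distortion: difference quotients differ by a factor at most `e^π`. -/
theorem DistBound.sub_mul_sub_le {φ : ℝ → ℝ} {π : ℝ} (hφ : ContDiffOn ℝ 1 φ (Icc 0 1))
    (hd : ∀ x ∈ Icc (0 : ℝ) 1, 0 < derivWithin φ (Icc 0 1) x) (hπ : DistBound φ π)
    {s t s' t' : ℝ} (hs : 0 ≤ s) (hst : s ≤ t) (ht : t ≤ 1)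
    (hs' : 0 ≤ s') (hst' : s' ≤ t') (ht' : t' ≤ 1) :
    (φ t' - φ s') * (t - s) ≤ Real.exp π * (φ t - φ s) * (t' - s') := by
  obtain ⟨x, hx, h⟩ := exists_derivWithin_mul_sub hφ hs hst ht
  obtain ⟨y, hy, h'⟩ := exists_derivWithin_mul_sub hφ hs' hst' ht'
  have h1 : derivWithin φ (Icc 0 1) y ≤ Real.exp π * derivWithin φ (Icc 0 1) x := by
    rw [← div_le_iff₀ (hd x hx), ← Real.log_le_iff_le_exp (div_pos (hd y hy) (hd x hx))]
    exact hπ x hx y hy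
  rw [h, h']
  nlinarith [mul_le_mul_of_nonneg_right h1
    (mul_nonneg (sub_nonneg.2 hst) (sub_nonneg.2 hst'))]

/-- The branches `f` on `[0,c]` and `g` on `[c,1]` of a Lorenz map with critical values `a = f c`
and `b = g c`, together with the estimates and the orbit data of a monotone renormalization on
which the bounds for the central intervals depend. -/
structure RenormBranches (ρ π c a b : ℝ) (f g : ℝ → ℝ) (n m : ℕ) (p q : ℝ) : Prop where
  one_lt_rho : 1 < ρ
  pi_pos : 0 < π
  c_pos : 0 < c
  c_lt_one : c < 1
  b_nonneg : 0 ≤ b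
  a_le_one : a ≤ 1
  b_lt_c : b < c
  c_lt_a : c < a
  n_pos : 1 ≤ n
  m_pos : 1 ≤ m
  p_pos : 0 < p
  p_lt_c : p < c
  c_lt_q : c < q
  q_lt_one : q < 1
  left_mono : MonotoneOn f (Icc 0 c)
  right_mono : MonotoneOn g (Icc c 1)
  left_zero : f 0 = 0
  left_crit : f c = a
  right_crit : g c = b
  right_one : g 1 = 1
  left_slope : ∀ x y, 0 ≤ x → x ≤ y → y ≤ c →
    etaC ρ π (1 - c) (1 - a) * (f y - f x) ≤ ((c - x) / c) ^ (ρ - 1) * (y - x)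
  right_slope : ∀ x y, c ≤ x → x ≤ y → y ≤ 1 →
    etaC ρ π c b * (g y - g x) ≤ ((y - c) / (1 - c)) ^ (ρ - 1) * (y - x)
  left_flat : ∀ x, 0 ≤ x → x ≤ c → a - f x ≤ Real.exp π * a * ((c - x) / c) ^ ρ
  right_flat : ∀ x, c ≤ x → x ≤ 1 →
    g x - b ≤ Real.exp π * (1 - b) * ((x - c) / (1 - c)) ^ ρ
  left_orbit : ∀ k < n, g^[k] (f p) ∈ Ioc c 1
  right_orbit : ∀ k < m, f^[k] (g q) ∈ Ico 0 c
  left_fix : g^[n] (f p) = p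
  right_fix : f^[m] (g q) = q
  left_return : ∀ x ∈ Ico p c, g^[n] (f x) ≤ q
  right_return : ∀ x ∈ Ioc c q, p ≤ f^[m] (g x)
  left_nontrivial : c < g^[n] a
  right_nontrivial : f^[m] b < c

namespace RenormBranches

variable {ρ π c a b : ℝ} {f g : ℝ → ℝ} {n m : ℕ} {p q : ℝ}

/-- The reflection `x ↦ 1 - x` exchanges the two branches. -/
theorem reflect (h : RenormBranches ρ π c a b f g n m p q) :
    RenormBranches ρ π (1 - c) (1 - b) (1 - a) (fun x => 1 - g (1 - x)) (fun x => 1 - f (1 - x))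
      m n (1 - q) (1 - p) where
  one_lt_rho := h.one_lt_rho
  pi_pos := h.pi_pos
  c_pos := by linarith [h.c_lt_one]
  c_lt_one := by linarith [h.c_pos]
  b_nonneg := by linarith [h.a_le_one]
  a_le_one := by linarith [h.b_nonneg]
  b_lt_c := by linarith [h.c_lt_a]
  c_lt_a := by linarith [h.b_lt_c]
  n_pos := h.m_pos
  m_pos := h.n_pos
  p_pos := by linarith [h.q_lt_one]
  p_lt_c := by linarith [h.c_lt_q]
  c_lt_q := by linarith [h.p_lt_c]
  q_lt_one := by linarith [h.p_pos]
  left_mono := by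
    intro x hx y hy hxy
    have := h.right_mono
      (show 1 - y ∈ Icc c 1 from ⟨by linarith [hy.2], by linarith [hy.1]⟩)
      (show 1 - x ∈ Icc c 1 from ⟨by linarith [hx.2], by linarith [hx.1]⟩) (by linarith)
    simp only
    linarith
  right_mono := by
    intro x hx y hy hxy
    have := h.left_mono
      (show 1 - y ∈ Icc 0 c from ⟨by linarith [hy.2], by linarith [hy.1]⟩)
      (show 1 - x ∈ Icc 0 c from ⟨by linarith [hx.2], by linarith [hx.1]⟩) (by linarith)
    simp only
    linarith
  left_zero := by simp [h.right_one]
  left_crit := by simp [h.right_crit]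
  right_crit := by simp [h.left_crit]
  right_one := by simp [h.left_zero]
  left_slope := by
    intro x y hx hxy hy
    have := h.right_slope (1 - y) (1 - x) (by linarith) (by linarith) (by linarith)
    convert this using 2 <;> ring_nf
  right_slope := by
    intro x y hx hxy hy
    have := h.left_slope (1 - y) (1 - x) (by linarith) (by linarith) (by linarith)
    convert this using 2 <;> ring_nf
  left_flat := by
    intro x hx hxc
    have := h.right_flat (1 - x) (by linarith) (by linarith)
    convert this using 1 <;> ring_nf
  right_flat := by
    intro x hx hxc
    have := h.left_flat (1 - x) (by linarith) (by linarith)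
    convert this using 1 <;> ring_nf
  left_orbit := by
    intro k hk
    have := h.right_orbit k hk
    simp only [sub_sub_cancel, iterate_one_sub]
    exact ⟨by linarith [this.2], by linarith [this.1]⟩
  right_orbit := by
    intro k hk
    have := h.left_orbit k hk
    simp only [sub_sub_cancel, iterate_one_sub]
    exact ⟨by linarith [this.2], by linarith [this.1]⟩
  left_fix := by simp only [sub_sub_cancel, iterate_one_sub, h.right_fix]
  right_fix := by simp only [sub_sub_cancel, iterate_one_sub, h.left_fix]
  left_return := by
    intro x hx
    have := h.right_return (1 - x) ⟨by linarith [hx.2], by linarith [hx.1]⟩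
    simp only [iterate_one_sub]
    linarith
  right_return := by
    intro x hx
    have := h.left_return (1 - x) ⟨by linarith [hx.2], by linarith [hx.1]⟩
    simp only [iterate_one_sub]
    linarith
  left_nontrivial := by
    rw [iterate_one_sub]
    linarith [h.right_nontrivial]
  right_nontrivial := by
    rw [iterate_one_sub]
    linarith [h.left_nontrivial]

theorem eta_pos (h : RenormBranches ρ π c a b f g n m p q) : 0 < etaC ρ π c b := by
  have h1 : 0 < 1 - c := by linarith [h.c_lt_one]
  have h2 : 0 < 1 - b := by linarith [h.b_lt_c]
  have h3 : 0 < ρ := by linarith [h.one_lt_rho]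
  unfold etaC
  positivity

theorem eta_lt (h : RenormBranches ρ π c a b f g n m p q) : etaC ρ π c b < 1 / ρ := by
  have h1 : 0 < 1 - c := by linarith [h.c_lt_one]
  have h2 : 1 - c < 1 - b := by linarith [h.b_lt_c]
  have h3 : 0 < ρ := by linarith [h.one_lt_rho]
  have h4 : Real.exp (-π) < 1 := Real.exp_lt_one_iff.2 (by linarith [h.pi_pos])
  unfold etaC
  rw [div_lt_div_iff₀ (by nlinarith) h3]
  have : Real.exp (-π) * (1 - c) < 1 - b := by nlinarith
  nlinarith

theorem eta_lt_one (h : RenormBranches ρ π c a b f g n m p q) : etaC ρ π c b < 1 :=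
  h.eta_lt.trans ((div_lt_one (by linarith [h.one_lt_rho])).2 h.one_lt_rho)

/-- The right branch expands by at most `1 / η`. -/
theorem right_slope_le (h : RenormBranches ρ π c a b f g n m p q) {x y : ℝ} (hx : c ≤ x)
    (hxy : x ≤ y) (hy : y ≤ 1) : etaC ρ π c b * (g y - g x) ≤ y - x := by
  have h1 : 0 < 1 - c := by linarith [h.c_lt_one]
  have h2 : ((y - c) / (1 - c)) ^ (ρ - 1) ≤ 1 :=
    Real.rpow_le_one (div_nonneg (by linarith) h1.le) ((div_le_one h1).2 (by linarith))
      (by linarith [h.one_lt_rho])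
  exact (h.right_slope x y hx hxy hy).trans (mul_le_of_le_one_left (by linarith) h2)

theorem orbit_le (h : RenormBranches ρ π c a b f g n m p q) {x : ℝ} (hx : x ∈ Ico p c) {k : ℕ}
    (hk : k ≤ n) : g^[k] (f p) ≤ g^[k] (f x) ∧ g^[k] (f x) ≤ g^[k] a ∧ g^[k] a ≤ 1 := by
  have h0 : p ∈ Icc 0 c := ⟨h.p_pos.le, h.p_lt_c.le⟩
  have h1 : x ∈ Icc 0 c := ⟨h.p_pos.le.trans hx.1, hx.2.le⟩
  have h2 : f p ≤ f x := h.left_mono h0 h1 hx.1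
  have h3 : f x ≤ a := h.left_crit ▸ h.left_mono h1 ⟨h.c_pos.le, le_rfl⟩ hx.2.le
  have key := fun {y z : ℝ} (hyz : y ≤ z) (hz : z ≤ 1) =>
    iterate_le_iterate_of_monotoneOn (y := y) (x := z) h.right_mono h.right_one h.c_lt_one.le
      hyz hz
  have h4 : ∀ j < n, c ≤ g^[j] (f p) := fun j hj => (h.left_orbit j hj).1.le
  have h5 : ∀ j ≤ n, g^[j] (f p) ≤ g^[j] (f x) := fun j hj =>
    (key h2 (h3.trans h.a_le_one) j fun i hi => h4 i (by omega)).1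
  have h6 := key h3 h.a_le_one k fun i hi => (h4 i (by omega)).trans (h5 i (by omega))
  exact ⟨h5 k hk, h6⟩

theorem c_lt_orbit (h : RenormBranches ρ π c a b f g n m p q) {k : ℕ} (hk : k ≤ n) :
    c < g^[k] a := by
  rcases hk.eq_or_lt with rfl | hk
  · exact h.left_nontrivial
  have h1 := h.orbit_le ⟨le_rfl, h.p_lt_c⟩ hk.le
  exact (h.left_orbit k hk).1.trans_le h1.2.1

theorem eta_pow_mul_orbit_sub_le (h : RenormBranches ρ π c a b f g n m p q) {x : ℝ}
    (hx : x ∈ Ico p c) :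
    ∀ k ≤ n, etaC ρ π c b ^ k * (g^[k] a - g^[k] (f x)) ≤ a - f x
  | 0, _ => by simp
  | k + 1, hk => by
    have ih := h.eta_pow_mul_orbit_sub_le hx k (by omega)
    obtain ⟨h1, h2, h3⟩ := h.orbit_le hx (k := k) (by omega)
    have h4 := h.right_slope_le ((h.left_orbit k (by omega)).1.le.trans h1) h2 h3
    refine le_trans ?_ ih
    rw [pow_succ, mul_assoc, Function.iterate_succ_apply', Function.iterate_succ_apply']
    exact mul_le_mul_of_nonneg_left h4 (pow_pos h.eta_pos k).le

/-- The critical value returns to `[p,q]`. -/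
theorem orbit_return_le (h : RenormBranches ρ π c a b f g n m p q) : g^[n] a ≤ q := by
  have hη := pow_pos h.eta_pos n
  set M := Real.exp π * a / c with hM
  have hMpos : 0 < M := by
    have := h.c_pos
    have := h.c_pos.trans h.c_lt_a
    positivity
  have key : ∀ x ∈ Ico p c, etaC ρ π c b ^ n * (g^[n] a - q) ≤ M * (c - x) := by
    intro x hx
    have h0 : 0 ≤ x := h.p_pos.le.trans hx.1
    have h1 := h.eta_pow_mul_orbit_sub_le hx n le_rfl
    have h2 := h.left_flat x h0 hx.2.le
    have h3 : ((c - x) / c) ^ ρ ≤ (c - x) / c := by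
      have h4 : (c - x) / c ≤ 1 := (div_le_one h.c_pos).2 (by linarith)
      have h5 : 0 ≤ (c - x) / c := div_nonneg (by linarith [hx.2]) h.c_pos.le
      simpa using Real.rpow_le_rpow_of_exponent_ge' h5 h4 zero_le_one h.one_lt_rho.le
    have h6 : Real.exp π * a * ((c - x) / c) ^ ρ ≤ M * (c - x) := by
      have := mul_le_mul_of_nonneg_left h3
        (mul_pos (Real.exp_pos π) (h.c_pos.trans h.c_lt_a)).le
      rwa [mul_div_assoc', ← div_mul_eq_mul_div] at this
    have h7 := mul_le_mul_of_nonneg_left (sub_le_sub_left (h.left_return x hx) (g^[n] a)) hη.le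
    linarith
  by_contra! hlt
  set d := etaC ρ π c b ^ n * (g^[n] a - q) with hd
  have hdpos : 0 < d := mul_pos hη (by linarith)
  have h1 := key (max p (c - d / (2 * M))) ⟨le_max_left _ _,
    max_lt h.p_lt_c (by linarith [div_pos hdpos (mul_pos two_pos hMpos)])⟩
  have h2 : M * (c - max p (c - d / (2 * M))) ≤ M * (d / (2 * M)) :=
    mul_le_mul_of_nonneg_left (by linarith [le_max_right p (c - d / (2 * M))]) hMpos.le
  have h3 : M * (d / (2 * M)) = d / 2 := by field_simp
  linarith

/-- The constant `ξ ^ (ρ / (ρ - 1)) e ^ (-π / (ρ - 1))` bounds how close preimages of `q` under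
iterates of the left branch come to the critical point. -/
theorem xi_mul_rpow_le (h : RenormBranches ρ π c a b f g n m p q) (hqa : q ≤ a) :
    xiC ρ c a ^ (ρ / (ρ - 1)) * Real.exp (-π / (ρ - 1)) * (a - q) ^ (1 / ρ ^ m) ≤ c - g q := by
  have hρ := h.one_lt_rho
  have hρ0 : 0 < ρ := by linarith
  have hρ1 : 0 < ρ - 1 := by linarith
  have ha : 0 < a := h.c_pos.trans h.c_lt_a
  have hξ : 0 < xiC ρ c a := div_pos h.c_pos (Real.rpow_pos_of_pos ha _)
  have hξ1 : xiC ρ c a ≤ 1 := by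
    refine (div_le_one (Real.rpow_pos_of_pos ha _)).2 (h.c_lt_a.le.trans ?_)
    have := Real.rpow_le_rpow_of_exponent_ge ha h.a_le_one
      (show 1 / ρ ≤ 1 from (div_le_one hρ0).2 hρ.le)
    simpa using this
  set T := xiC ρ c a ^ (ρ / (ρ - 1)) * Real.exp (-π / (ρ - 1)) with hT
  have hT0 : 0 < T := mul_pos (Real.rpow_pos_of_pos hξ _) (Real.exp_pos _)
  have hT1 : T ≤ 1 := by
    refine mul_le_one₀ (Real.rpow_le_one hξ.le hξ1 (by positivity)) (Real.exp_pos _).le ?_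
    exact Real.exp_le_one_iff.2 (div_nonpos_of_nonpos_of_nonneg (by linarith [h.pi_pos]) hρ1.le)
  have hTρ : xiC ρ c a ^ ρ * T = Real.exp π * T ^ ρ := by
    rw [hT, Real.mul_rpow (Real.rpow_nonneg hξ.le _) (Real.exp_pos _).le, ← Real.rpow_mul hξ.le,
      ← Real.exp_mul, ← mul_assoc, ← Real.rpow_add hξ, mul_left_comm, ← Real.exp_add]
    congr 2
    · field_simp; ring
    · field_simp; ring
  have hξρ : xiC ρ c a ^ ρ = c ^ ρ / a := by
    rw [xiC, Real.div_rpow h.c_pos.le (Real.rpow_nonneg ha.le _), ← Real.rpow_mul ha.le,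
      one_div_mul_cancel hρ0.ne', Real.rpow_one]
  have hd : 0 ≤ a - q := by linarith
  have step : ∀ (j : ℕ) (z : ℝ), z ∈ Ico 0 c →
      T * (a - q) ^ (1 / ρ ^ j) ≤ a - f z → T * (a - q) ^ (1 / ρ ^ (j + 1)) ≤ c - z := by
    intro j z hz hj
    have h1 := h.left_flat z hz.1 hz.2.le
    have hcz : 0 ≤ c - z := by linarith [hz.2]
    rw [Real.div_rpow hcz h.c_pos.le] at h1
    have hcρ := Real.rpow_pos_of_pos h.c_pos ρ
    have h2 : xiC ρ c a ^ ρ * (a - f z) ≤ Real.exp π * (c - z) ^ ρ := by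
      rw [hξρ]
      calc c ^ ρ / a * (a - f z)
          ≤ c ^ ρ / a * (Real.exp π * a * ((c - z) ^ ρ / c ^ ρ)) :=
            mul_le_mul_of_nonneg_left h1 (by positivity)
        _ = Real.exp π * (c - z) ^ ρ := by field_simp
    have h3 : Real.exp π * (T * (a - q) ^ (1 / ρ ^ (j + 1))) ^ ρ ≤ Real.exp π * (c - z) ^ ρ := by
      refine le_trans (le_of_eq ?_)
        ((mul_le_mul_of_nonneg_left hj (Real.rpow_pos_of_pos hξ ρ).le).trans h2)
      rw [Real.mul_rpow hT0.le (Real.rpow_nonneg hd _), ← Real.rpow_mul hd, ← mul_assoc, ← hTρ,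
        mul_assoc, pow_succ]
      congr 3
      field_simp
    exact (Real.rpow_le_rpow_iff (mul_nonneg hT0.le (Real.rpow_nonneg hd _)) hcz hρ0).1
      (le_of_mul_le_mul_left h3 (Real.exp_pos π))
  have main : ∀ (j : ℕ) (z : ℝ), (∀ i < j, f^[i] z ∈ Ico 0 c) → f^[j] z = q →
      T * (a - q) ^ (1 / ρ ^ j) ≤ a - z := by
    intro j
    induction j with
    | zero =>
      rintro z - rfl
      simpa using mul_le_of_le_one_left hd hT1
    | succ j ih =>
      intro z hz hzq
      have h1 := step j z (hz 0 (by omega)) (ih (f z) (fun i hi => hz (i + 1) (by omega)) hzq)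
      linarith [h.c_lt_a]
  obtain ⟨j, hj⟩ : ∃ j, m = j + 1 := ⟨m - 1, by have := h.m_pos; omega⟩
  have hz := h.right_orbit
  have hzq := h.right_fix
  rw [hj] at hz hzq ⊢
  exact step j _ (hz 0 (by omega)) (main j _ (fun i hi => hz (i + 1) (by omega)) hzq)

/-- `Θ` bounds the gap between `R` and the critical value from below. -/
theorem theta_le (h : RenormBranches ρ π c a b f g n m p q) :
    0 ≤ ThetaC ρ π c a b m ∧ ThetaC ρ π c a b m ≤ a - q := by
  have hρ := h.one_lt_rho
  have hρ0 : 0 < ρ := by linarith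
  have ha : 0 < a := h.c_pos.trans h.c_lt_a
  have hα : 0 < a - c := by linarith [h.c_lt_a]
  have hμ : 0 < 1 - c := by linarith [h.c_lt_one]
  have hga : c < g a := h.c_lt_orbit (k := 1) h.n_pos
  have hgq : g q < c := (h.right_orbit 0 h.m_pos).2
  have hqa : q < a := by
    by_contra! hle
    have := h.right_mono ⟨h.c_lt_a.le, h.a_le_one⟩ ⟨h.c_lt_q.le, h.q_lt_one.le⟩ hle
    linarith
  have hd : 0 < a - q := by linarith
  have h1 := h.xi_mul_rpow_le hqa.le
  set T := xiC ρ c a ^ (ρ / (ρ - 1)) * Real.exp (-π / (ρ - 1)) with hT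
  have hξ : 0 < xiC ρ c a := div_pos h.c_pos (Real.rpow_pos_of_pos ha _)
  have hT0 : 0 < T := mul_pos (Real.rpow_pos_of_pos hξ _) (Real.exp_pos _)
  have hη := h.eta_pos
  set A := ((1 - c) / (a - c)) ^ (ρ - 1) with hA
  have hA0 : 0 < A := Real.rpow_pos_of_pos (div_pos hμ hα) _
  have hAinv : A * ((a - c) / (1 - c)) ^ (ρ - 1) = 1 := by
    rw [hA, ← Real.mul_rpow (div_pos hμ hα).le (div_pos hα hμ).le]
    have : (1 - c) / (a - c) * ((a - c) / (1 - c)) = 1 := by field_simp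
    rw [this, Real.one_rpow]
  have hΘ : ThetaC ρ π c a b m = (etaC ρ π c b * A * T) ^ (ρ ^ m / (ρ ^ m - 1)) := by
    rw [ThetaC, hT, ← mul_assoc]
  have h2 : etaC ρ π c b * A * T * (a - q) ^ (1 / ρ ^ m) ≤ a - q := by
    have h3 := mul_le_mul_of_nonneg_left
      (h.right_slope q a h.c_lt_q.le hqa.le h.a_le_one) hA0.le
    rw [← mul_assoc A (_ ^ _), hAinv, one_mul] at h3
    have h4 := mul_le_mul_of_nonneg_left (h1.trans (by linarith : c - g q ≤ g a - g q))
      (mul_pos hη hA0).le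
    linarith
  have hρm : 1 < ρ ^ m := one_lt_pow₀ hρ (by have := h.m_pos; omega)
  have hρm1 : 0 < ρ ^ m - 1 := by linarith
  have h5 : etaC ρ π c b * A * T ≤ (a - q) ^ (1 - 1 / ρ ^ m) := by
    rw [Real.rpow_sub hd, Real.rpow_one, le_div_iff₀ (Real.rpow_pos_of_pos hd _)]
    exact h2
  have hX : 0 < etaC ρ π c b * A * T := by positivity
  rw [hΘ]
  refine ⟨Real.rpow_nonneg hX.le _, ?_⟩
  refine (Real.rpow_le_rpow hX.le h5 (by positivity)).trans_eq ?_
  rw [← Real.rpow_mul hd.le]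
  have : (1 - 1 / ρ ^ m) * (ρ ^ m / (ρ ^ m - 1)) = 1 := by field_simp
  rw [this, Real.rpow_one]

/-- The exponent in the lower bound is at most the relative distance to `1` of the last point of
the critical orbit before its return. -/
theorem exponent_le (h : RenormBranches ρ π c a b f g n m p q) {r : ℕ} (hr : n = r + 1) :
    (1 - 1 / ρ) * (etaC ρ π c b ^ n * ThetaC ρ π c a b m /
        ((1 - c) * (1 - etaC ρ π c b ^ n))) *
      ∑ k ∈ Finset.range n, ((Real.exp (-(2 * π)) / etaC ρ π c b) *
        ((ThetaC ρ π c a b m + (q - c)) / (1 - c)) ^ (ρ - 1)) ^ k ≤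
    (1 - g^[r] a) / (1 - c) := by
  obtain ⟨hΘ0, hΘ⟩ := h.theta_le
  have hη := h.eta_pos
  have hη1 := h.eta_lt_one
  have hμ : 0 < 1 - c := by linarith [h.c_lt_one]
  have hηρ := h.eta_lt
  have hgap : etaC ρ π c b * (1 - q) ≤ 1 - g^[r] a := by
    have h1 := h.right_slope_le (h.c_lt_orbit (k := r) (by omega)).le
      (h.orbit_le ⟨le_rfl, h.p_lt_c⟩ (k := r) (by omega)).2.2 le_rfl
    have h2 := h.orbit_return_le
    rw [hr, Function.iterate_succ_apply'] at h2
    rw [h.right_one] at h1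
    exact (mul_le_mul_of_nonneg_left (by linarith) hη.le).trans h1
  generalize ThetaC ρ π c a b m = Θ at *
  generalize etaC ρ π c b = η at *
  have hηn : η ^ n < 1 := pow_lt_one₀ hη.le hη1 (by have := h.n_pos; omega)
  have hsum : ∑ k ∈ Finset.range n, ((Real.exp (-(2 * π)) / η) *
      ((Θ + (q - c)) / (1 - c)) ^ (ρ - 1)) ^ k ≤ ∑ k ∈ Finset.range n, (1 / η) ^ k := by
    have h0 : 0 ≤ (Θ + (q - c)) / (1 - c) := div_nonneg (by linarith [h.c_lt_q]) hμ.le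
    have h1 : ((Θ + (q - c)) / (1 - c)) ^ (ρ - 1) ≤ 1 :=
      Real.rpow_le_one h0 ((div_le_one hμ).2 (by linarith [h.a_le_one]))
        (by linarith [h.one_lt_rho])
    have h2 : Real.exp (-(2 * π)) ≤ 1 := Real.exp_le_one_iff.2 (by linarith [h.pi_pos])
    have h3 := Real.rpow_nonneg h0 (ρ - 1)
    refine Finset.sum_le_sum fun k _ => pow_le_pow_left₀ (by positivity) ?_ k
    exact (mul_le_of_le_one_right (by positivity) h1).trans
      (div_le_div_of_nonneg_right h2 hη.le)
  have hgeom : (1 - η) * (η ^ n * ∑ k ∈ Finset.range n, (1 / η) ^ k) = η * (1 - η ^ n) := by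
    have h1 := mul_neg_geom_sum (1 / η) n
    have h2 : η ^ n * (1 / η) ^ n = 1 := by
      rw [← mul_pow, mul_one_div_cancel hη.ne', one_pow]
    have h3 : 1 - η = -η * (1 - 1 / η) := by field_simp; ring
    rw [h3]
    linear_combination (-η * η ^ n) * h1 + η * h2
  have hS0 : 0 ≤ ∑ k ∈ Finset.range n, (1 / η) ^ k := Finset.sum_nonneg fun k _ => by positivity
  have hK : 0 ≤ 1 - 1 / ρ := by
    linarith [(div_le_one (by linarith [h.one_lt_rho])).2 h.one_lt_rho.le]
  have h1n : 0 < 1 - η ^ n := by linarith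
  calc _ ≤ (1 - 1 / ρ) * (η ^ n * Θ / ((1 - c) * (1 - η ^ n))) *
        ∑ k ∈ Finset.range n, (1 / η) ^ k := mul_le_mul_of_nonneg_left hsum (by positivity)
    _ ≤ (1 - η) * (η ^ n * Θ / ((1 - c) * (1 - η ^ n))) *
        ∑ k ∈ Finset.range n, (1 / η) ^ k := by
      refine mul_le_mul_of_nonneg_right (mul_le_mul_of_nonneg_right (by linarith) ?_) hS0
      positivity
    _ = ((1 - η) * (η ^ n * ∑ k ∈ Finset.range n, (1 / η) ^ k)) *
        (Θ / ((1 - c) * (1 - η ^ n))) := by ring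
    _ = η * Θ / (1 - c) := by rw [hgeom]; field_simp
    _ ≤ _ := by
      refine div_le_div_of_nonneg_right (le_trans ?_ hgap) hμ.le
      exact mul_le_mul_of_nonneg_left (by linarith [h.a_le_one]) hη.le

/-- The lower bound for the length of the left central interval. -/
theorem left_length_bound (h : RenormBranches ρ π c a b f g n m p q) :
    (Real.exp (-π) * c ^ ρ * etaC ρ π c b ^ n / a) ^ (1 / (ρ - 1)) *
      Real.exp ((1 - 1 / ρ) * (etaC ρ π c b ^ n * ThetaC ρ π c a b m /
          ((1 - c) * (1 - etaC ρ π c b ^ n))) *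
        ∑ k ∈ Finset.range n, ((Real.exp (-(2 * π)) / etaC ρ π c b) *
          ((ThetaC ρ π c a b m + (q - c)) / (1 - c)) ^ (ρ - 1)) ^ k) ≤ c - p := by
  obtain ⟨r, hr⟩ : ∃ r, n = r + 1 := ⟨n - 1, by have := h.n_pos; omega⟩
  have hexp := h.exponent_le hr
  have hη := h.eta_pos
  have hμ : 0 < 1 - c := by linarith [h.c_lt_one]
  have hρ1 : 0 < ρ - 1 := by linarith [h.one_lt_rho]
  have ha : 0 < a := h.c_pos.trans h.c_lt_a
  have hL : 0 < c - p := by linarith [h.p_lt_c]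
  have hcρ := Real.rpow_pos_of_pos h.c_pos ρ
  have hp : p ∈ Ico p c := ⟨le_rfl, h.p_lt_c⟩
  set t := (g^[r] a - c) / (1 - c) with ht
  have ht0 : 0 < t := div_pos (by linarith [h.c_lt_orbit (k := r) (by omega)]) hμ
  have htexp : t ≤ Real.exp (-((1 - g^[r] a) / (1 - c))) := by
    refine le_trans (le_of_eq ?_) (Real.one_sub_le_exp_neg _)
    rw [ht]; field_simp; ring
  have hbase : Real.exp (-π) * c ^ ρ * etaC ρ π c b ^ n / a ≤ (t * (c - p)) ^ (ρ - 1) := by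
    obtain ⟨h1, h2, h3⟩ := h.orbit_le hp (k := r) (by omega)
    have h4 := h.right_slope _ _ (h.left_orbit r (by omega)).1.le h2 h3
    have h5 := h.eta_pow_mul_orbit_sub_le hp r (by omega)
    have h6 := h.left_flat p h.p_pos.le h.p_lt_c.le
    have h7 := h.left_nontrivial
    have h8 := h.left_fix
    rw [hr, Function.iterate_succ_apply'] at h7 h8
    rw [h8, ← ht] at h4
    have ht1 := Real.rpow_pos_of_pos ht0 (ρ - 1)
    have h9 : etaC ρ π c b ^ n * (c - p) ≤
        t ^ (ρ - 1) * (Real.exp π * a * ((c - p) / c) ^ ρ) := by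
      calc etaC ρ π c b ^ n * (c - p)
          = etaC ρ π c b ^ r * (etaC ρ π c b * (c - p)) := by rw [hr, pow_succ, mul_assoc]
        _ ≤ etaC ρ π c b ^ r * (t ^ (ρ - 1) * (g^[r] a - g^[r] (f p))) := by
          refine mul_le_mul_of_nonneg_left (le_trans ?_ h4) (pow_pos hη r).le
          exact mul_le_mul_of_nonneg_left (by linarith) hη.le
        _ = t ^ (ρ - 1) * (etaC ρ π c b ^ r * (g^[r] a - g^[r] (f p))) := by ring
        _ ≤ _ := mul_le_mul_of_nonneg_left (h5.trans h6) ht1.le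
    have h10 : (c - p) ^ ρ = (c - p) ^ (ρ - 1) * (c - p) := by
      rw [← Real.rpow_add_one hL.ne']; ring_nf
    rw [Real.div_rpow hL.le h.c_pos.le, h10] at h9
    have h11 : etaC ρ π c b ^ n ≤ t ^ (ρ - 1) * (Real.exp π * a * ((c - p) ^ (ρ - 1) / c ^ ρ)) :=
      le_of_mul_le_mul_right (h9.trans_eq (by ring)) hL
    rw [Real.mul_rpow ht0.le hL.le]
    calc Real.exp (-π) * c ^ ρ * etaC ρ π c b ^ n / a
        = Real.exp (-π) * c ^ ρ / a * etaC ρ π c b ^ n := by ring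
      _ ≤ Real.exp (-π) * c ^ ρ / a *
          (t ^ (ρ - 1) * (Real.exp π * a * ((c - p) ^ (ρ - 1) / c ^ ρ))) :=
        mul_le_mul_of_nonneg_left h11 (by positivity)
      _ = t ^ (ρ - 1) * (c - p) ^ (ρ - 1) := by
        rw [Real.exp_neg]; field_simp
  have hroot : (Real.exp (-π) * c ^ ρ * etaC ρ π c b ^ n / a) ^ (1 / (ρ - 1)) ≤ t * (c - p) := by
    refine (Real.rpow_le_rpow (by positivity) hbase (by positivity)).trans_eq ?_
    rw [← Real.rpow_mul (by positivity), mul_one_div_cancel hρ1.ne', Real.rpow_one]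
  calc _ ≤ t * (c - p) * Real.exp ((1 - g^[r] a) / (1 - c)) :=
        mul_le_mul hroot (Real.exp_le_exp.2 hexp) (Real.exp_pos _).le (by positivity)
    _ ≤ Real.exp (-((1 - g^[r] a) / (1 - c))) * (c - p) *
        Real.exp ((1 - g^[r] a) / (1 - c)) := by gcongr
    _ = c - p := by
      rw [Real.exp_neg]; field_simp

end RenormBranches

/-- The branches of a renormalizable Lorenz map of bounded distortion. -/
theorem MonotoneRenorm.renormBranches {ρ π u v c : ℝ} {φ ψ : ℝ → ℝ} {n m : ℕ} {p q : ℝ}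
    (hπ : 0 < π) (hL : IsLorenz 1 ρ u v c φ ψ) (hφ : DistBound φ π) (hψ : DistBound ψ π)
    (hR : MonotoneRenorm ρ u v c φ ψ n m p q) :
    RenormBranches ρ π c (φ u) (ψ (1 - v)) (fun x => φ (u * (1 - ((c - x) / c) ^ ρ)))
      (fun x => ψ (1 + v * (-1 + ((x - c) / (1 - c)) ^ ρ))) n m p q := by
  obtain ⟨hρ, hu, hu1, hv, hv1, hc, hc1, hφs, hψs, hφ0, hφ1, hψ0, hψ1, hφd, hψd⟩ := hL
  obtain ⟨hn, hm, hp, hpc, hcq, hq, hlr, hlf, hrr, hrf, hli, hri, hnl, hnr⟩ := hR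
  norm_cast at hφs hψs
  have hρ0 : 0 < ρ := by linarith
  have hμ : 0 < 1 - c := by linarith
  have hφm := monotoneOn_of_derivWithin_pos hφs hφd
  have hψm := monotoneOn_of_derivWithin_pos hψs hψd
  set F := lorenzF ρ u v c φ ψ with hF
  set f : ℝ → ℝ := fun x => φ (u * (1 - ((c - x) / c) ^ ρ)) with hf
  set g : ℝ → ℝ := fun x => ψ (1 + v * (-1 + ((x - c) / (1 - c)) ^ ρ)) with hg
  have hFf : ∀ x, x < c → F x = f x := fun x hx => if_pos hx
  have hFg : ∀ x, c ≤ x → F x = g x := fun x hx => if_neg (not_lt.2 hx)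
  have left_mem : ∀ x, 0 ≤ x → x ≤ c → 0 ≤ (c - x) / c ∧ (c - x) / c ≤ 1 ∧
      0 ≤ ((c - x) / c) ^ ρ ∧ ((c - x) / c) ^ ρ ≤ 1 := by
    intro x hx hxc
    have h1 : 0 ≤ (c - x) / c := div_nonneg (by linarith) hc.le
    have h2 : (c - x) / c ≤ 1 := (div_le_one hc).2 (by linarith)
    exact ⟨h1, h2, Real.rpow_nonneg h1 _, Real.rpow_le_one h1 h2 hρ0.le⟩
  have right_mem : ∀ x, c ≤ x → x ≤ 1 → 0 ≤ (x - c) / (1 - c) ∧ (x - c) / (1 - c) ≤ 1 ∧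
      0 ≤ ((x - c) / (1 - c)) ^ ρ ∧ ((x - c) / (1 - c)) ^ ρ ≤ 1 := by
    intro x hx hxc
    have h1 : 0 ≤ (x - c) / (1 - c) := div_nonneg (by linarith) hμ.le
    have h2 : (x - c) / (1 - c) ≤ 1 := (div_le_one hμ).2 (by linarith)
    exact ⟨h1, h2, Real.rpow_nonneg h1 _, Real.rpow_le_one h1 h2 hρ0.le⟩
  have left_diff : ∀ x y, 0 ≤ x → x ≤ y → y ≤ c → f x ≤ f y ∧
      f y - f x ≤ Real.exp π * φ u * (((c - x) / c) ^ ρ - ((c - y) / c) ^ ρ) := by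
    intro x y hx hxy hy
    obtain ⟨h1, h2, h3, h4⟩ := left_mem x hx (hxy.trans hy)
    obtain ⟨h5, h6, h7, h8⟩ := left_mem y (hx.trans hxy) hy
    have h9 : ((c - y) / c) ^ ρ ≤ ((c - x) / c) ^ ρ :=
      Real.rpow_le_rpow h5 (by gcongr) hρ0.le
    have h10 : 0 ≤ u * (1 - ((c - x) / c) ^ ρ) := mul_nonneg hu.le (by linarith)
    have h11 : u * (1 - ((c - x) / c) ^ ρ) ≤ u * (1 - ((c - y) / c) ^ ρ) := by gcongr
    have h12 : u * (1 - ((c - y) / c) ^ ρ) ≤ 1 := mul_le_one₀ hu1 (by linarith) (by linarith)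
    refine ⟨hφm ⟨h10, h11.trans h12⟩ ⟨h10.trans h11, h12⟩ h11, ?_⟩
    have h13 := hφ.sub_mul_sub_le hφs hφd le_rfl hu.le hu1 h10 h11 h12
    rw [hφ0, sub_zero, sub_zero] at h13
    exact le_of_mul_le_mul_right (h13.trans_eq (by ring)) hu
  have right_diff : ∀ x y, c ≤ x → x ≤ y → y ≤ 1 → g x ≤ g y ∧
      g y - g x ≤ Real.exp π * (1 - ψ (1 - v)) *
        (((y - c) / (1 - c)) ^ ρ - ((x - c) / (1 - c)) ^ ρ) := by
    intro x y hx hxy hy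
    obtain ⟨h1, h2, h3, h4⟩ := right_mem x hx (hxy.trans hy)
    obtain ⟨h5, h6, h7, h8⟩ := right_mem y (hx.trans hxy) hy
    have h9 : ((x - c) / (1 - c)) ^ ρ ≤ ((y - c) / (1 - c)) ^ ρ :=
      Real.rpow_le_rpow h1 (by gcongr) hρ0.le
    have h10 : 0 ≤ 1 + v * (-1 + ((x - c) / (1 - c)) ^ ρ) := by
      nlinarith [mul_nonneg hv.le h3]
    have h11 : 1 + v * (-1 + ((x - c) / (1 - c)) ^ ρ) ≤
        1 + v * (-1 + ((y - c) / (1 - c)) ^ ρ) := by gcongr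
    have h12 : 1 + v * (-1 + ((y - c) / (1 - c)) ^ ρ) ≤ 1 := by
      nlinarith
    refine ⟨hψm ⟨h10, h11.trans h12⟩ ⟨h10.trans h11, h12⟩ h11, ?_⟩
    have h13 := hψ.sub_mul_sub_le hψs hψd (s := 1 - v) (t := 1) (by linarith) (by linarith)
      le_rfl h10 h11 h12
    rw [hψ1, sub_sub_cancel] at h13
    exact le_of_mul_le_mul_right (h13.trans_eq (by ring)) hv
  have hfc : f c = φ u := by simp [hf, Real.zero_rpow hρ0.ne']
  have hf0 : f 0 = 0 := by simp [hf, hc.ne', hφ0]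
  have hgc : g c = ψ (1 - v) := by simp [hg, Real.zero_rpow hρ0.ne', sub_eq_add_neg]
  have hg1 : g 1 = 1 := by simp [hg, hμ.ne', hψ1]
  have hfm : MonotoneOn f (Icc 0 c) := fun x hx y hy hxy => (left_diff x y hx.1 hxy hy.2).1
  have hgm : MonotoneOn g (Icc c 1) := fun x hx y hy hxy => (right_diff x y hx.1 hxy hy.2).1
  have ha1 : φ u ≤ 1 := hφ1 ▸ hφm ⟨hu.le, hu1⟩ ⟨zero_le_one, le_rfl⟩ hu1
  have hb0 : 0 ≤ ψ (1 - v) :=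
    hψ0 ▸ hψm ⟨le_rfl, zero_le_one⟩ ⟨by linarith, by linarith⟩ (by linarith)
  have left_iter : ∀ x ∈ Ico p c, ∀ k ≤ n, F^[k + 1] x = g^[k] (f x) := by
    intro x hx k hk
    rw [Function.iterate_succ_apply, hFf x hx.2]
    refine iterate_eq_of_eq_on_orbit k fun j hj => hFg _ ?_
    have := (hli (j + 1) (by omega) (by omega)).1 ⟨x, hx, rfl⟩
    rw [Function.iterate_succ_apply, hFf x hx.2] at this
    exact this.1.le
  have right_iter : ∀ x ∈ Ioc c q, ∀ k ≤ m, F^[k + 1] x = f^[k] (g x) := by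
    intro x hx k hk
    rw [Function.iterate_succ_apply, hFg x hx.1.le]
    refine iterate_eq_of_eq_on_orbit k fun j hj => hFf _ ?_
    have := (hri (j + 1) (by omega) (by omega)).1 ⟨x, hx, rfl⟩
    rw [Function.iterate_succ_apply, hFg x hx.1.le] at this
    exact this.2
  have hpm : p ∈ Ico p c := ⟨le_rfl, hpc⟩
  have hqm : q ∈ Ioc c q := ⟨hcq, le_rfl⟩
  have left_orbit : ∀ k < n, g^[k] (f p) ∈ Ioc c 1 := fun k hk =>
    left_iter p hpm k hk.le ▸ (hli (k + 1) (by omega) (by omega)).1 ⟨p, hpm, rfl⟩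
  have right_orbit : ∀ k < m, f^[k] (g q) ∈ Ico 0 c := fun k hk =>
    right_iter q hqm k hk.le ▸ (hri (k + 1) (by omega) (by omega)).1 ⟨q, hqm, rfl⟩
  have hfpa : f p ≤ φ u := hfc ▸ (left_diff p c hp.le hpc.le le_rfl).1
  have hbgq : ψ (1 - v) ≤ g q := hgc ▸ (right_diff c q le_rfl hcq.le hq.le).1
  have left_crit_orbit : ∀ k < n, c < g^[k] (φ u) := fun k hk =>
    (left_orbit k hk).1.trans_le (iterate_le_iterate_of_monotoneOn hgm hg1 hc1.le hfpa ha1 k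
      fun j hj => (left_orbit j (by omega)).1.le).1
  have right_crit_orbit : ∀ k < m, f^[k] (ψ (1 - v)) < c := fun k hk =>
    (iterate_le_iterate_of_monotoneOn_left hfm hf0 hc.le hbgq hb0 k
      fun j hj => (right_orbit j (by omega)).2.le).1.trans_lt (right_orbit k hk).2
  have hca : c < φ u := left_crit_orbit 0 (by omega)
  have hbc : ψ (1 - v) < c := right_crit_orbit 0 (by omega)
  refine ⟨hρ, hπ, hc, hc1, hb0, ha1, hbc, hca, hn, hm, hp, hpc, hcq, hq, hfm, hgm, hf0, hfc, hgc,
    hg1, ?_, ?_, ?_, ?_, left_orbit, right_orbit, ?_, ?_, ?_, ?_, ?_, ?_⟩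
  · intro x y hx hxy hy
    have h1 := (left_diff x y hx hxy hy).2
    have h2 := rpow_sub_rpow_le hρ (left_mem y (hx.trans hxy) hy).1
      (show (c - y) / c ≤ (c - x) / c by gcongr)
    have ha : 0 < φ u := hc.trans hca
    rw [etaC, sub_sub_cancel, sub_sub_cancel]
    calc _ ≤ Real.exp (-π) * c / (φ u * ρ) * (Real.exp π * φ u *
          (ρ * ((c - x) / c) ^ (ρ - 1) * ((c - x) / c - (c - y) / c))) := by
          refine mul_le_mul_of_nonneg_left (h1.trans ?_) (by positivity)
          exact mul_le_mul_of_nonneg_left h2 (by positivity)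
      _ = _ := by
        rw [Real.exp_neg]
        generalize ((c - x) / c) ^ (ρ - 1) = r
        field_simp
        ring
  · intro x y hx hxy hy
    have h1 := (right_diff x y hx hxy hy).2
    have h2 := rpow_sub_rpow_le hρ (right_mem x hx (hxy.trans hy)).1
      (show (x - c) / (1 - c) ≤ (y - c) / (1 - c) by gcongr)
    have hb : 0 < 1 - ψ (1 - v) := by linarith
    rw [etaC]
    calc _ ≤ Real.exp (-π) * (1 - c) / ((1 - ψ (1 - v)) * ρ) * (Real.exp π * (1 - ψ (1 - v)) *
          (ρ * ((y - c) / (1 - c)) ^ (ρ - 1) * ((y - c) / (1 - c) - (x - c) / (1 - c)))) := by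
          refine mul_le_mul_of_nonneg_left (h1.trans ?_) (by positivity)
          exact mul_le_mul_of_nonneg_left h2 (by positivity)
      _ = _ := by
        rw [Real.exp_neg]
        generalize ((y - c) / (1 - c)) ^ (ρ - 1) = r
        field_simp
        ring
  · intro x hx hxc
    have := (left_diff x c hx hxc le_rfl).2
    rwa [hfc, sub_self, zero_div, Real.zero_rpow hρ0.ne', sub_zero] at this
  · intro x hx hx1
    have := (right_diff c x le_rfl hx hx1).2
    rwa [hgc, sub_self, zero_div, Real.zero_rpow hρ0.ne', sub_zero] at this
  · exact left_iter p hpm n le_rfl ▸ hlf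
  · exact right_iter q hqm m le_rfl ▸ hrf
  · exact fun x hx => left_iter x hx n le_rfl ▸ (hlr hx).2
  · exact fun x hx => right_iter x hx m le_rfl ▸ (hrr hx).1
  · rwa [← iterate_eq_of_eq_on_orbit (F := g) (G := F) n fun j hj =>
      (hFg _ (left_crit_orbit j hj).le).symm] at hnl
  · rwa [← iterate_eq_of_eq_on_orbit (F := f) (G := F) m fun j hj =>
      (hFf _ (right_crit_orbit j hj)).symm] at hnr

/-- Lower bounds on the central intervals: for `0 < 2π < log ρ` there is a constant
`K > 0` such that for every Lorenz map in `K^π` renormalizable of monotone type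
`(0 1ⁿ, 1 0ᵐ)`,
`|L| ≥ (e^{-π} c^ρ ηⁿ/c₁⁻)^{1/(ρ-1)} exp(K (ηⁿΘ/(μ(1-ηⁿ))) Σ_{k=1}^{n} ((e^{-2π}/η)((Θ+|R|)/μ)^{ρ-1})^{k-1})`
and similarly for `|R|`. -/
theorem central_interval_lower_bounds (ρ π : ℝ)
    (hπ : 0 < π) (hπρ : 2 * π < Real.log ρ) :
    ∃ K : ℝ, 0 < K ∧
      ∀ (u v c : ℝ) (φ ψ : ℝ → ℝ) (n m : ℕ) (p q : ℝ),
        IsLorenz 1 ρ u v c φ ψ → DistBound φ π → DistBound ψ π →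
        MonotoneRenorm ρ u v c φ ψ n m p q →
        (Real.exp (-π) * c ^ ρ * etaC ρ π c (ψ (1 - v)) ^ n / φ u) ^ (1 / (ρ - 1)) *
            Real.exp (K * (etaC ρ π c (ψ (1 - v)) ^ n *
                ThetaC ρ π c (φ u) (ψ (1 - v)) m /
                ((1 - c) * (1 - etaC ρ π c (ψ (1 - v)) ^ n))) *
              ∑ k ∈ Finset.range n,
                ((Real.exp (-(2 * π)) / etaC ρ π c (ψ (1 - v))) *
                  ((ThetaC ρ π c (φ u) (ψ (1 - v)) m + (q - c)) / (1 - c)) ^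
                    (ρ - 1)) ^ k) ≤ c - p ∧
          (Real.exp (-π) * (1 - c) ^ ρ * kappaC ρ π c (φ u) ^ m / (1 - ψ (1 - v))) ^
              (1 / (ρ - 1)) *
            Real.exp (K * (kappaC ρ π c (φ u) ^ m *
                DeltaC ρ π c (φ u) (ψ (1 - v)) n /
                (c * (1 - kappaC ρ π c (φ u) ^ m))) *
              ∑ k ∈ Finset.range m,
                ((Real.exp (-(2 * π)) / kappaC ρ π c (φ u)) *
                  ((DeltaC ρ π c (φ u) (ψ (1 - v)) n + (c - p)) / c) ^
                    (ρ - 1)) ^ k) ≤ q - c := by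
  have hρ : 1 < |ρ| := by
    by_contra! hle
    have := Real.log_nonpos (abs_nonneg ρ) hle
    rw [Real.log_abs] at this
    linarith
  have hK : 1 / ρ < 1 := by
    refine (le_abs_self _).trans_lt ?_
    rw [abs_div, abs_one, div_lt_one (by linarith)]
    exact hρ
  refine ⟨1 - 1 / ρ, by linarith, fun u v c φ ψ n m p q hL hφ hψ hR => ?_⟩
  have h := hR.renormBranches hπ hL hφ hψ
  refine ⟨h.left_length_bound, ?_⟩
  have h2 := h.reflect.left_length_bound
  have hκ : etaC ρ π (1 - c) (1 - φ u) = kappaC ρ π c (φ u) := by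
    simp only [etaC, kappaC, sub_sub_cancel]
  have hΔ : ThetaC ρ π (1 - c) (1 - ψ (1 - v)) (1 - φ u) n =
      DeltaC ρ π c (φ u) (ψ (1 - v)) n := by
    simp only [ThetaC, DeltaC, hκ, xiC, nuC, sub_sub_cancel, sub_sub_sub_cancel_left]
  rw [hκ, hΔ] at h2
  simpa only [sub_sub_cancel, sub_sub_sub_cancel_left] using h2
end
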